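/- There exists a nonempty compact set Y ⊆ ∂𝔻̄² with (0,0) ∈ Ŷ and P(Y) having dense invertibles, such that, setting X = Ŷ and E = {(z,w) ∈ X : |w| ≥ 1/4}, the image of E under the continuous map η : (z,w) ↦ (|w|, z/w) into ℝ × ℂ contains the three-dimensional set [1/4, 1] × {ζ ∈ ℂ : |ζ| ≤ 1}. -/

import Mathlib

open BoundedContinuousFunction Set

noncomputable def pev (q : MvPolynomial (Fin 2) ℂ) (z : ℂ × ℂ) : ℂ :=
  MvPolynomial.eval ![z.1, z.2] q

def bidisk : Set (ℂ × ℂ) := {z : ℂ × ℂ | ‖z.1‖ ≤ 1 ∧ ‖z.2‖ ≤ 1}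

def polyHull (Y : Set (ℂ × ℂ)) : Set (ℂ × ℂ) :=
  {z : ℂ × ℂ | ∀ (q : MvPolynomial (Fin 2) ℂ) (M : ℝ),
    (∀ y ∈ Y, ‖pev q y‖ ≤ M) → ‖pev q z‖ ≤ M}

/-- The subalgebra of `Y →ᵇ ℂ` consisting of restrictions to `Y` of polynomial
functions in the two complex coordinates. -/
noncomputable def polySub (Y : Set (ℂ × ℂ)) : Subalgebra ℂ (Y →ᵇ ℂ) where
  carrier := {f : Y →ᵇ ℂ | ∃ q : MvPolynomial (Fin 2) ℂ, ∀ y : Y, f y = pev q ↑y}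
  mul_mem' := by
    rintro f g ⟨q, hq⟩ ⟨r, hr⟩
    exact ⟨q * r, fun y => by simp [pev, hq y, hr y]⟩
  one_mem' := ⟨1, fun y => by simp [pev]⟩
  add_mem' := by
    rintro f g ⟨q, hq⟩ ⟨r, hr⟩
    exact ⟨q + r, fun y => by simp [pev, hq y, hr y]⟩
  zero_mem' := ⟨0, fun y => by simp [pev]⟩
  algebraMap_mem' := fun c => ⟨MvPolynomial.C c, fun y => by simp [pev]⟩

/-- `P(Y)`: the uniform closure of the polynomial restrictions, as a Banach algebra
(a closed subalgebra of the bounded continuous functions on `Y`). -/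
noncomputable def PY (Y : Set (ℂ × ℂ)) : Subalgebra ℂ (Y →ᵇ ℂ) :=
  (polySub Y).topologicalClosure

open Topology Metric

theorem eventually_differentiableAt_circleIntegral {G : ℂ × ℂ → ℂ} {z₀ w₀ : ℂ} {r : ℝ}
    (hr : 0 ≤ r) (hG : ∀ w ∈ sphere w₀ r, AnalyticAt ℂ G (z₀, w)) :
    ∀ᶠ z in 𝓝 z₀, DifferentiableAt ℂ (fun z => ∮ w in C(w₀, r), G (z, w)) z := by
  obtain ⟨u, v, hu, -, hzu, hv, huv⟩ := generalized_tube_lemma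
    (isCompact_singleton (x := z₀)) (isCompact_sphere w₀ r) (isOpen_analyticAt ℂ G)
    (by rintro ⟨z, w⟩ ⟨rfl, hw⟩; exact hG w hw)
  filter_upwards [hu.mem_nhds (hzu rfl)] with z hz
  obtain ⟨ρ, hρ, hρu⟩ := nhds_basis_closedBall.mem_iff.1 (hu.mem_nhds hz)
  have hA : ∀ x ∈ u, ∀ w ∈ sphere w₀ r, AnalyticAt ℂ G (x, w) :=
    fun x hx w hw => huv ⟨hx, hv hw⟩
  have hmem : ∀ θ, circleMap w₀ r θ ∈ sphere w₀ r := circleMap_mem_sphere w₀ hr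
  have hcont : ∀ x ∈ u, Continuous fun θ : ℝ => G (x, circleMap w₀ r θ) := by
    intro x hx
    refine continuous_iff_continuousAt.2 fun θ => ?_
    exact ContinuousAt.comp (f := fun θ : ℝ => (x, circleMap w₀ r θ)) (g := G)
      (hA x hx _ (hmem θ)).continuousAt (by fun_prop)
  have hcont' : ∀ x ∈ u, Continuous fun θ : ℝ => fderiv ℂ G (x, circleMap w₀ r θ) (1, 0) := by
    intro x hx
    refine continuous_iff_continuousAt.2 fun θ => ?_
    exact (ContinuousAt.comp (f := fun θ : ℝ => (x, circleMap w₀ r θ)) (g := fderiv ℂ G)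
      (hA x hx _ (hmem θ)).fderiv.continuousAt (by fun_prop)).clm_apply continuousAt_const
  have hdc : Continuous (deriv (circleMap w₀ r)) := by
    simp only [funext (deriv_circleMap w₀ r)]; fun_prop
  obtain ⟨B, hB⟩ := ((isCompact_closedBall z ρ).prod
    (isCompact_sphere w₀ r)).exists_bound_of_continuousOn
      (f := fun x => fderiv ℂ G x (1, 0)) (by
        rintro ⟨x, w⟩ ⟨hx, hw⟩
        exact ((hA x (hρu hx) w hw).fderiv.continuousAt.clm_apply
          continuousAt_const).continuousWithinAt)
  have key := (intervalIntegral.hasDerivAt_integral_of_dominated_loc_of_deriv_le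
    (𝕜 := ℂ) (μ := MeasureTheory.volume) (a := 0) (b := 2 * Real.pi)
    (F := fun x θ => deriv (circleMap w₀ r) θ • G (x, circleMap w₀ r θ))
    (F' := fun x θ => deriv (circleMap w₀ r) θ • fderiv ℂ G (x, circleMap w₀ r θ) (1, 0))
    (x₀ := z) (s := closedBall z ρ) (bound := fun _ => r * B)
    (closedBall_mem_nhds z hρ)
    (by
      filter_upwards [hu.mem_nhds hz] with x hx
      exact (hdc.smul (hcont x hx)).aestronglyMeasurable)
    ((hdc.smul (hcont z hz)).intervalIntegrable _ _)
    ((hdc.smul (hcont' z hz)).aestronglyMeasurable)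
    (by
      refine Filter.Eventually.of_forall fun θ _ x hx => ?_
      rw [norm_smul]
      refine mul_le_mul ?_ (hB (x, circleMap w₀ r θ) ⟨hx, hmem θ⟩) (norm_nonneg _) hr
      simp [deriv_circleMap, abs_of_nonneg hr])
    (by simp)
    (by
      refine Filter.Eventually.of_forall fun θ _ x hx => ?_
      refine HasDerivAt.const_smul (deriv (circleMap w₀ r) θ) ?_
      have h1 := (hA x (hρu hx) _ (hmem θ)).differentiableAt.hasFDerivAt
      exact h1.comp_hasDerivAt (f := fun x => (x, circleMap w₀ r θ)) x
        ((hasDerivAt_id x).prodMk (hasDerivAt_const x _)))).2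
  exact key.differentiableAt

/-- Residue theorem for `g` times the logarithmic derivative of a polynomial. -/
theorem circleIntegral_mul_sum_inv_sub {g : ℂ → ℂ} {c : ℂ} {r : ℝ} (hr : 0 < r)
    (hg : DifferentiableOn ℂ g (closedBall c r)) (s : Multiset ℂ) (hs : ∀ a ∈ s, a ∉ sphere c r) :
    CircleIntegrable (fun w => g w * (s.map fun a => 1 / (w - a)).sum) c r ∧
    (∮ w in C(c, r), g w * (s.map fun a => 1 / (w - a)).sum) =
      2 * Real.pi * Complex.I * ((s.filter fun a => dist a c < r).map g).sum := by
  induction s using Multiset.induction with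
  | empty => simp [circleIntegral]
  | cons a s ih =>
    obtain ⟨ih1, ih2⟩ := ih fun b hb => hs b (Multiset.mem_cons_of_mem hb)
    have ha : a ∉ sphere c r := hs a (Multiset.mem_cons_self a s)
    have hI : CircleIntegrable (fun w => g w * (1 / (w - a))) c r := by
      refine ContinuousOn.circleIntegrable hr.le ?_
      refine (hg.continuousOn.mono sphere_subset_closedBall).mul ?_
      refine continuousOn_const.div (by fun_prop) fun w hw => ?_
      rw [sub_ne_zero]; rintro rfl; exact ha hw
    have hval : (∮ w in C(c, r), g w * (1 / (w - a))) =
        2 * Real.pi * Complex.I * (if dist a c < r then g a else 0) := by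
      split_ifs with h
      · have := hg.circleIntegral_sub_inv_smul (w := a) h
        simpa [smul_eq_mul, mul_comm] using this
      · rw [mul_zero]
        have h' : a ∉ closedBall c r := fun h1 =>
          ha (le_antisymm h1 (not_lt.1 h))
        have hd : DifferentiableOn ℂ (fun w => g w * (1 / (w - a))) (closedBall c r) := by
          refine hg.mul (DifferentiableOn.div (by fun_prop) (by fun_prop) fun w hw => ?_)
          rw [sub_ne_zero]; rintro rfl; exact h' hw
        exact Complex.circleIntegral_eq_zero_of_differentiable_on_off_countable hr.le
          Set.countable_empty hd.continuousOn fun z hz =>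
            hd.differentiableAt (closedBall_mem_nhds_of_mem hz.1)
    have hsum : (fun w => g w * ((a ::ₘ s).map fun a => 1 / (w - a)).sum) =
        fun w => g w * (1 / (w - a)) + g w * (s.map fun a => 1 / (w - a)).sum := by
      funext w; simp [mul_add]
    rw [hsum]
    refine ⟨hI.add ih1, ?_⟩
    rw [circleIntegral.integral_add hI ih1, hval, ih2, ← mul_add]
    congr 1
    split_ifs with h <;> simp [h]

/-- The restriction of a polynomial in two variables to a vertical line. -/
noncomputable def slicePoly (q : MvPolynomial (Fin 2) ℂ) (z : ℂ) : Polynomial ℂ :=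
  MvPolynomial.aeval ![Polynomial.C z, Polynomial.X] q

theorem eval_slicePoly (q : MvPolynomial (Fin 2) ℂ) (z w : ℂ) :
    (slicePoly q z).eval w = pev q (z, w) := by
  induction q using MvPolynomial.induction_on with
  | C a => simp [slicePoly, pev]
  | add p q hp hq => simp_all [slicePoly, pev]
  | mul_X p i hp => fin_cases i <;> simp_all [slicePoly, pev]

theorem eval_derivative_slicePoly (q : MvPolynomial (Fin 2) ℂ) (z w : ℂ) :
    (slicePoly q z).derivative.eval w = pev (MvPolynomial.pderiv 1 q) (z, w) := by
  rw [← eval_slicePoly]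
  congr 1
  induction q using MvPolynomial.induction_on with
  | C a => simp [slicePoly]
  | add p q hp hq => simp_all [slicePoly]
  | mul_X p i hp =>
    fin_cases i <;> simp_all [slicePoly, MvPolynomial.pderiv_X, mul_comm]

theorem analyticAt_pev (q : MvPolynomial (Fin 2) ℂ) (x : ℂ × ℂ) : AnalyticAt ℂ (pev q) x := by
  induction q using MvPolynomial.induction_on with
  | C a =>
    have : pev (MvPolynomial.C a) = fun _ => a := by funext y; simp [pev]
    rw [this]; exact analyticAt_const
  | add p q hp hq =>
    have : pev (p + q) = fun y => pev p y + pev q y := by funext y; simp [pev]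
    rw [this]; exact hp.add hq
  | mul_X p i hp =>
    fin_cases i
    · have : pev (p * MvPolynomial.X 0) = fun y => pev p y * y.1 := by funext y; simp [pev]
      exact this ▸ hp.mul analyticAt_fst
    · have : pev (p * MvPolynomial.X 1) = fun y => pev p y * y.2 := by funext y; simp [pev]
      exact this ▸ hp.mul analyticAt_snd

theorem continuous_pev (q : MvPolynomial (Fin 2) ℂ) : Continuous (pev q) :=
  continuous_iff_continuousAt.2 fun x => (analyticAt_pev q x).continuousAt

theorem eq_of_norm_sum_eq {s : Multiset ℂ} {f : ℂ → ℂ} {m : ℝ} (hs : 0 < s.card)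
    (hf : ∀ a ∈ s, ‖f a‖ ≤ m) (h : ‖(s.map f).sum‖ = s.card * m) : ∃ a ∈ s, ‖f a‖ = m := by
  by_contra! hne
  have hlt : ∀ a ∈ s, ‖f a‖ < m := fun a ha => lt_of_le_of_ne (hf a ha) (hne a ha)
  have h1 : ‖(s.map f).sum‖ ≤ (s.map fun a => ‖f a‖).sum := by
    simpa [Multiset.map_map, Function.comp_def] using norm_multiset_sum_le (s.map f)
  have h2 : (s.map fun a => ‖f a‖).sum < (s.map fun _ => m).sum :=
    Multiset.sum_lt_sum_of_nonempty (Multiset.card_pos.1 hs) hlt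
  simp at h2
  linarith

theorem norm_sum_le_card_mul {s : Multiset ℂ} {f : ℂ → ℂ} {m : ℝ}
    (hf : ∀ a ∈ s, ‖f a‖ ≤ m) : ‖(s.map f).sum‖ ≤ s.card * m := by
  have h1 : ‖(s.map f).sum‖ ≤ (s.map fun a => ‖f a‖).sum := by
    simpa [Multiset.map_map, Function.comp_def] using norm_multiset_sum_le (s.map f)
  have h2 : (s.map fun a => ‖f a‖).sum ≤ (s.map fun _ => m).sum :=
    Multiset.sum_map_le_sum_map _ _ hf
  simp at h2
  linarith

/-- The sum of `h (z, ·)` over the roots in a disc of `F (z, ·)` is holomorphic in `z`. -/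
theorem eventually_differentiableAt_sum_roots {F : MvPolynomial (Fin 2) ℂ} {z₀ w₀ : ℂ} {r : ℝ}
    (hr : 0 < r) (hF : ∀ w ∈ sphere w₀ r, pev F (z₀, w) ≠ 0) {h : ℂ × ℂ → ℂ}
    (hh : ∀ w ∈ closedBall w₀ r, AnalyticAt ℂ h (z₀, w)) :
    ∀ᶠ z in 𝓝 z₀, DifferentiableAt ℂ (fun z =>
      (((slicePoly F z).roots.filter fun a => dist a w₀ < r).map fun w => h (z, w)).sum) z := by
  have hG : ∀ w ∈ sphere w₀ r, AnalyticAt ℂ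
      (fun x => h x * (pev (MvPolynomial.pderiv 1 F) x / pev F x)) (z₀, w) := fun w hw =>
    (hh w (sphere_subset_closedBall hw)).mul ((analyticAt_pev _ _).div (analyticAt_pev _ _) (hF w hw))
  have hd := eventually_differentiableAt_circleIntegral hr.le hG
  obtain ⟨u, v, hu, -, hzu, hv, huv⟩ := generalized_tube_lemma
    (isCompact_singleton (x := z₀)) (isCompact_sphere w₀ r)
    (isOpen_ne_fun (continuous_pev F) continuous_const)
    (by rintro ⟨z, w⟩ ⟨rfl, hw⟩; exact hF w hw)
  obtain ⟨u', v', hu', -, hzu', hv', huv'⟩ := generalized_tube_lemma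
    (isCompact_singleton (x := z₀)) (isCompact_closedBall w₀ r)
    (isOpen_analyticAt ℂ h)
    (by rintro ⟨z, w⟩ ⟨rfl, hw⟩; exact hh w hw)
  have heq : ∀ z ∈ u ∩ u', (∮ w in C(w₀, r),
      h (z, w) * (pev (MvPolynomial.pderiv 1 F) (z, w) / pev F (z, w))) =
      2 * Real.pi * Complex.I *
      (((slicePoly F z).roots.filter fun a => dist a w₀ < r).map fun w => h (z, w)).sum := by
    rintro z ⟨hz, hz'⟩
    have hne : ∀ w ∈ sphere w₀ r, (slicePoly F z).eval w ≠ 0 := fun w hw => by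
      rw [eval_slicePoly]; exact huv ⟨hz, hv hw⟩
    rw [← (circleIntegral_mul_sum_inv_sub (g := fun w => h (z, w)) hr (fun w hw => ?_)
      (slicePoly F z).roots fun a ha ha' => hne a ha' (Polynomial.mem_roots'.1 ha).2).2]
    · refine circleIntegral.integral_congr hr.le fun w hw => ?_
      rw [← (IsAlgClosed.splits (slicePoly F z)).eval_derivative_div_eval_of_ne_zero (hne w hw),
        eval_derivative_slicePoly, eval_slicePoly]
    · exact ((huv' ⟨hz', hv' hw⟩ : AnalyticAt ℂ h (z, w)).differentiableAt.comp (f := fun w => (z, w)) w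
        (by fun_prop)).differentiableWithinAt
  have hopen : IsOpen (u ∩ u') := hu.inter hu'
  filter_upwards [hd, hopen.mem_nhds ⟨hzu rfl, hzu' rfl⟩] with z hdz hz
  refine (hdz.const_mul (2 * Real.pi * Complex.I)⁻¹).congr_of_eventuallyEq ?_
  filter_upwards [hopen.mem_nhds hz] with y hy
  rw [heq y hy, inv_mul_cancel_left₀ Complex.two_pi_I_ne_zero]

/-- Points of a curve where a holomorphic function attains a local maximum of its modulus
persist over nearby values of the first coordinate. -/
theorem eventually_exists_eq_norm_of_isLocalMax {F : MvPolynomial (Fin 2) ℂ} {h : ℂ × ℂ → ℂ}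
    {W : Set (ℂ × ℂ)} {z₀ w₀ : ℂ} (hF0 : slicePoly F z₀ ≠ 0) (hF : pev F (z₀, w₀) = 0)
    (hW : W ∈ 𝓝 (z₀, w₀)) (hh : AnalyticAt ℂ h (z₀, w₀))
    (hmax : ∀ y ∈ W, pev F y = 0 → ‖h y‖ ≤ ‖h (z₀, w₀)‖) :
    ∀ᶠ z in 𝓝 z₀, ∃ w, (z, w) ∈ W ∧ pev F (z, w) = 0 ∧ ‖h (z, w)‖ = ‖h (z₀, w₀)‖ := by
  have hfin : ((slicePoly F z₀).roots.toFinset.erase w₀ : Set ℂ).Finite := Finset.finite_toSet _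
  have hnhds : {w : ℂ | (z₀, w) ∈ interior W ∧ AnalyticAt ℂ h (z₀, w) ∧
      w ∉ ((slicePoly F z₀).roots.toFinset.erase w₀ : Set ℂ)} ∈ 𝓝 w₀ := by
    have hc : ContinuousAt (fun w : ℂ => (z₀, w)) w₀ := by fun_prop
    have h1 := hc.eventually (interior_mem_nhds.2 hW)
    have h2 := hc.eventually hh.eventually_analyticAt
    have h3 := hfin.isClosed.isOpen_compl.mem_nhds
      (show w₀ ∉ ((slicePoly F z₀).roots.toFinset.erase w₀ : Set ℂ) by simp)
    filter_upwards [h1, h2, h3] with w h1 h2 h3 using ⟨h1, h2, h3⟩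
  obtain ⟨r, hr, hball⟩ := nhds_basis_closedBall.mem_iff.1 hnhds
  have hroot : ∀ w ∈ closedBall w₀ r, pev F (z₀, w) = 0 → w = w₀ := by
    intro w hw h0
    by_contra hne
    refine (hball hw).2.2 ?_
    simp [hne, hF0, eval_slicePoly, h0]
  have hFs : ∀ w ∈ sphere w₀ r, pev F (z₀, w) ≠ 0 := by
    intro w hw h0
    have := hroot w (sphere_subset_closedBall hw) h0
    subst this
    rw [mem_sphere, dist_self] at hw; exact hr.ne hw
  set R : ℂ → Multiset ℂ := fun z => (slicePoly F z).roots.filter fun a => dist a w₀ < r with hR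
  have hS := eventually_differentiableAt_sum_roots hr hFs (h := h) fun w hw => (hball hw).2.1
  have hN := eventually_differentiableAt_sum_roots hr hFs (h := fun _ => 1)
    fun w hw => analyticAt_const
  have hcard : ∀ᶠ z in 𝓝 z₀, (R z).card = (R z₀).card := by
    have h1 := hN.self_of_nhds.continuousAt
    have h2 := h1.eventually (ball_mem_nhds _ one_pos)
    filter_upwards [h2] with z hz
    have hdist : dist ((R z).card : ℂ) ((R z₀).card : ℂ) < 1 := by
      simpa [Multiset.map_const'] using hz
    have hnorm : ‖((((R z).card : ℤ) - ((R z₀).card : ℤ) : ℤ) : ℂ)‖ < 1 := by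
      push_cast; rwa [← dist_eq_norm]
    rw [Complex.norm_intCast] at hnorm
    have habs : |((R z).card : ℤ) - (R z₀).card| < 1 := by exact_mod_cast hnorm
    rw [Int.abs_lt_one_iff] at habs
    omega
  have hmem0 : ∀ a ∈ R z₀, a = w₀ := fun a ha => by
    have h1 := Multiset.mem_filter.1 ha
    exact hroot a h1.2.le (by rw [← eval_slicePoly]; exact (Polynomial.mem_roots'.1 h1.1).2)
  have hpos : 0 < (R z₀).card := by
    refine Multiset.card_pos_iff_exists_mem.2 ⟨w₀, Multiset.mem_filter.2 ⟨?_, by simpa using hr⟩⟩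
    rw [Polynomial.mem_roots hF0, Polynomial.IsRoot, eval_slicePoly, hF]
  have hS0 : ((R z₀).map fun w => h (z₀, w)).sum = (R z₀).card * h (z₀, w₀) := by
    have hmap : (R z₀).map (fun w => h (z₀, w)) = (R z₀).map fun _ => h (z₀, w₀) :=
      Multiset.map_congr rfl fun a ha => by rw [hmem0 a ha]
    rw [hmap]
    simp
  obtain ⟨u, v, hu, -, hzu, hv, huv⟩ := generalized_tube_lemma
    (isCompact_singleton (x := z₀)) (isCompact_closedBall w₀ r) (isOpen_interior (s := W))
    (by rintro ⟨z, w⟩ ⟨rfl, hw⟩; exact (hball hw).1)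
  have hRW : ∀ z ∈ u, ∀ a ∈ R z, (z, a) ∈ W ∧ pev F (z, a) = 0 := fun z hz a ha => by
    have h1 := Multiset.mem_filter.1 ha
    exact ⟨interior_subset (huv ⟨hz, hv h1.2.le⟩),
      by rw [← eval_slicePoly]; exact (Polynomial.mem_roots'.1 h1.1).2⟩
  have hle : ∀ z ∈ u, ∀ a ∈ R z, ‖h (z, a)‖ ≤ ‖h (z₀, w₀)‖ := fun z hz a ha =>
    hmax _ (hRW z hz a ha).1 (hRW z hz a ha).2
  have hu0 : ∀ᶠ z in 𝓝 z₀, z ∈ u := hu.mem_nhds (hzu rfl)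
  have hlm : IsLocalMax (norm ∘ fun z => ((R z).map fun w => h (z, w)).sum) z₀ := by
    filter_upwards [hu0, hcard] with z hz hc
    change ‖((R z).map fun w => h (z, w)).sum‖ ≤ ‖((R z₀).map fun w => h (z₀, w)).sum‖
    rw [hS0, norm_mul, Complex.norm_natCast, ← hc]
    exact norm_sum_le_card_mul (hle z hz)
  filter_upwards [Complex.norm_eventually_eq_of_isLocalMax hS hlm, hu0, hcard] with z h1 hz hc
  have h2 : ‖((R z).map fun w => h (z, w)).sum‖ = (R z).card * ‖h (z₀, w₀)‖ := by
    have hnorm : ‖((R z).map fun w => h (z, w)).sum‖ =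
        ‖((R z₀).map fun w => h (z₀, w)).sum‖ := h1
    rw [hnorm, hS0, norm_mul, Complex.norm_natCast, hc]
  obtain ⟨a, ha, hav⟩ := eq_of_norm_sum_eq (hc ▸ hpos) (hle z hz) h2
  exact ⟨a, (hRW z hz a ha).1, (hRW z hz a ha).2, hav⟩

/-- **Maximum principle on plane algebraic curves.** -/
theorem norm_le_of_forall_frontier_curve {F : MvPolynomial (Fin 2) ℂ} {h : ℂ × ℂ → ℂ}
    {Ω : Set (ℂ × ℂ)} (hΩ : IsOpen Ω) (hb : Bornology.IsBounded Ω)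
    (hh : ∀ x ∈ closure Ω, pev F x = 0 → AnalyticAt ℂ h x) {C : ℝ}
    (hC : ∀ x ∈ frontier Ω, pev F x = 0 → ‖h x‖ ≤ C) {x : ℂ × ℂ} (hx : x ∈ Ω)
    (hFx : pev F x = 0) : ‖h x‖ ≤ C := by
  set K : Set (ℂ × ℂ) := closure Ω ∩ {y | pev F y = 0} with hK
  have hKc : IsCompact K := hb.isCompact_closure.inter_right
    (isClosed_eq (continuous_pev F) continuous_const)
  have hcont : ContinuousOn (fun y => ‖h y‖) K := fun y hy =>
    (hh y hy.1 hy.2).continuousAt.norm.continuousWithinAt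
  obtain ⟨x₀, hx₀, hmax⟩ := hKc.exists_isMaxOn ⟨x, subset_closure hx, hFx⟩ hcont
  have hmax' : ∀ y ∈ K, ‖h y‖ ≤ ‖h x₀‖ := hmax
  by_contra! hlt
  have hCm : C < ‖h x₀‖ := hlt.trans_le (hmax' x ⟨subset_closure hx, hFx⟩)
  set M : Set (ℂ × ℂ) := K ∩ (fun y => ‖h y‖) ⁻¹' {‖h x₀‖} with hM
  have hMc : IsCompact M :=
    hKc.of_isClosed_subset (hcont.preimage_isClosed_of_isClosed hKc.isClosed isClosed_singleton)
      Set.inter_subset_left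
  have hMΩ : ∀ y ∈ M, y ∈ Ω := by
    intro y hy
    by_contra hn
    have := hC y ⟨hy.1.1, by rwa [hΩ.interior_eq]⟩ hy.1.2
    have h2 : ‖h y‖ = ‖h x₀‖ := hy.2
    linarith
  have hPc : IsCompact (Prod.fst '' M) := hMc.image continuous_fst
  have hPo : IsOpen (Prod.fst '' M) := by
    rw [isOpen_iff_mem_nhds]
    rintro _ ⟨⟨z₀, w₀⟩, hy, rfl⟩
    have hyv : ‖h (z₀, w₀)‖ = ‖h x₀‖ := hy.2
    by_cases hF0 : slicePoly F z₀ = 0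
    · exfalso
      have hz : ∀ w, pev F (z₀, w) = 0 := fun w => by rw [← eval_slicePoly, hF0]; simp
      have hcl : ∀ w ∈ closure ((fun w : ℂ => (z₀, w)) ⁻¹' Ω), (z₀, w) ∈ closure Ω := fun w hw =>
        (Continuous.prodMk_right z₀).closure_preimage_subset Ω hw
      have := Complex.norm_le_of_forall_mem_frontier_norm_le
        (U := (fun w : ℂ => (z₀, w)) ⁻¹' Ω) (f := fun w => h (z₀, w)) (C := C) (z := w₀) ?_ ?_ ?_
        (subset_closure (hMΩ _ hy))
      · linarith
      · refine (hb.image_snd).subset ?_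
        intro w hw
        exact ⟨(z₀, w), hw, rfl⟩
      · refine DifferentiableOn.diffContOnCl fun w hw => ?_
        exact ((hh _ (hcl w hw) (hz w)).differentiableAt.comp (f := fun w => (z₀, w)) w
          (by fun_prop)).differentiableWithinAt
      · intro w hw
        refine hC _ ⟨hcl w hw.1, ?_⟩ (hz w)
        rw [hΩ.interior_eq]
        have := hw.2
        rwa [(hΩ.preimage (Continuous.prodMk_right z₀)).interior_eq] at this
    · have := eventually_exists_eq_norm_of_isLocalMax hF0 hy.1.2 (hΩ.mem_nhds (hMΩ _ hy))
        (hh _ hy.1.1 hy.1.2) (fun y hyΩ hy0 => by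
          rw [hyv]; exact hmax' y ⟨subset_closure hyΩ, hy0⟩)
      filter_upwards [this] with z hz
      obtain ⟨w, h1, h2, h3⟩ := hz
      exact ⟨(z, w), ⟨⟨subset_closure h1, h2⟩, h3.trans hyv⟩, rfl⟩
  have huniv := IsClopen.eq_univ ⟨hPc.isClosed, hPo⟩ ⟨x₀.1, x₀, ⟨hx₀, rfl⟩, rfl⟩
  exact noncompact_univ ℂ (huniv ▸ hPc)

theorem pev_mul (p q : MvPolynomial (Fin 2) ℂ) (x : ℂ × ℂ) :
    pev (p * q) x = pev p x * pev q x := by simp [pev]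

theorem pev_add (p q : MvPolynomial (Fin 2) ℂ) (x : ℂ × ℂ) :
    pev (p + q) x = pev p x + pev q x := by simp [pev]

theorem pev_pow (p : MvPolynomial (Fin 2) ℂ) (n : ℕ) (x : ℂ × ℂ) :
    pev (p ^ n) x = pev p x ^ n := by simp [pev]

theorem pev_C (a : ℂ) (x : ℂ × ℂ) : pev (MvPolynomial.C a) x = a := by simp [pev]

theorem exists_norm_pev_le (q : MvPolynomial (Fin 2) ℂ) :
    ∃ B : ℝ, 1 ≤ B ∧ ∀ x ∈ closedBall (0 : ℂ × ℂ) 1, ‖pev q x‖ ≤ B := by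
  obtain ⟨B, hB⟩ := (isCompact_closedBall (0 : ℂ × ℂ) 1).exists_bound_of_continuousOn
    (continuous_pev q).continuousOn
  exact ⟨max B 1, le_max_right _ _, fun x hx => (hB x hx).trans (le_max_left _ _)⟩

/-- A sequence of polynomials not vanishing at the origin that is uniformly dense on the
bidisk. -/
theorem exists_seq_dense_pev_ne_zero : ∃ g : ℕ → MvPolynomial (Fin 2) ℂ,
    (∀ k, pev (g k) 0 ≠ 0) ∧ ∀ (p : MvPolynomial (Fin 2) ℂ) (ε : ℝ), 0 < ε →
      ∃ k, ∀ x ∈ closedBall (0 : ℂ × ℂ) 1, ‖pev p x - pev (g k) x‖ ≤ ε := by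
  have : CompactSpace (closedBall (0 : ℂ × ℂ) 1) :=
    isCompact_iff_compactSpace.1 (isCompact_closedBall _ _)
  let res : MvPolynomial (Fin 2) ℂ → C(closedBall (0 : ℂ × ℂ) 1, ℂ) := fun q =>
    ⟨fun x => pev q x, (continuous_pev q).comp continuous_subtype_val⟩
  let S : Set C(closedBall (0 : ℂ × ℂ) 1, ℂ) := res '' {q | pev q 0 ≠ 0}
  have : Nonempty S := ⟨⟨res 1, 1, by simp [pev], rfl⟩⟩
  obtain ⟨u, hu⟩ := TopologicalSpace.exists_dense_seq S
  choose g hg hgu using fun k => (u k).2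
  refine ⟨g, hg, fun p ε hε => ?_⟩
  obtain ⟨c, hc, hpc⟩ : ∃ c : ℂ, ‖c‖ ≤ ε / 2 ∧ pev (p + MvPolynomial.C c) 0 ≠ 0 := by
    by_cases hp : pev p 0 = 0
    · refine ⟨(ε / 2 : ℝ), ?_, ?_⟩
      · rw [Complex.norm_real, Real.norm_of_nonneg (by positivity)]
      · rw [pev_add, pev_C, hp, zero_add]
        exact_mod_cast (by positivity : ε / 2 ≠ 0)
    · exact ⟨0, by simpa using (by positivity : 0 ≤ ε / 2), by simpa using hp⟩
  obtain ⟨k, hk⟩ := hu.exists_dist_lt (⟨res (p + MvPolynomial.C c), _, hpc, rfl⟩ : S)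
    (half_pos hε)
  refine ⟨k, fun x hx => ?_⟩
  have h1 : dist (res (p + MvPolynomial.C c)) (u k : C(closedBall (0 : ℂ × ℂ) 1, ℂ)) < ε / 2 := hk
  rw [← hgu k] at h1
  have h2 := ((ContinuousMap.dist_apply_le_dist (⟨x, hx⟩ : closedBall (0 : ℂ × ℂ) 1)).trans_lt h1)
  have h3 : ‖pev (p + MvPolynomial.C c) x - pev (g k) x‖ < ε / 2 := by
    rw [← dist_eq_norm]; exact h2
  rw [pev_add, pev_C] at h3
  calc ‖pev p x - pev (g k) x‖ = ‖(pev p x + c - pev (g k) x) - c‖ := by ring_nf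
    _ ≤ ‖pev p x + c - pev (g k) x‖ + ‖c‖ := norm_sub_le _ _
    _ ≤ ε := by linarith

/-- Given `Q` with value `1` at the origin, one can divide by `g` a polynomial with value `1` at
the origin whose real part is at least `1 / 2` only where that of `Q` is. -/
theorem exists_dvd_of_half_le_re {Q g : MvPolynomial (Fin 2) ℂ} (hQ : pev Q 0 = 1)
    (hg : pev g 0 ≠ 0) : ∃ Q' : MvPolynomial (Fin 2) ℂ, pev Q' 0 = 1 ∧ g ∣ Q' ∧
      ∀ x ∈ closedBall (0 : ℂ × ℂ) 1, 1 / 2 ≤ (pev Q' x).re → 1 / 2 ≤ (pev Q x).re := by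
  obtain ⟨B, hB1, hB⟩ := exists_norm_pev_le Q
  obtain ⟨G, hG1, hG⟩ := exists_norm_pev_le (MvPolynomial.C (pev g 0)⁻¹ * g)
  set A : ℝ := B ^ 2 with hA
  have hA1 : 1 ≤ A := one_le_pow₀ hB1
  set ρ : ℝ := √(B ^ 2 + A + A ^ 2) / (1 + A) with hρ
  have hρ0 : 0 ≤ ρ := by positivity
  have hρ1 : ρ < 1 := by
    rw [hρ, div_lt_one (by positivity), Real.sqrt_lt' (by positivity)]
    nlinarith
  obtain ⟨N, hN⟩ := exists_pow_lt_of_lt_one (by positivity : 0 < 1 / (2 * G)) hρ1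
  have h1A : (1 + A : ℂ) ≠ 0 := by exact_mod_cast (by positivity : 1 + A ≠ 0)
  refine ⟨MvPolynomial.C (pev g 0)⁻¹ * g *
    (MvPolynomial.C (1 + A : ℂ)⁻¹ * (Q + MvPolynomial.C (A : ℂ))) ^ N, ?_, ?_, fun x hx h => ?_⟩
  · rw [pev_mul, pev_mul, pev_pow, pev_mul, pev_add, pev_C, pev_C, pev_C, hQ,
      inv_mul_cancel₀ hg, inv_mul_cancel₀ h1A, one_pow, one_mul]
  · exact (Dvd.intro_left _ rfl).mul_right _
  · by_contra! hlt
    have hζ : ‖pev Q x + A‖ ≤ √(B ^ 2 + A + A ^ 2) := by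
      refine Real.le_sqrt_of_sq_le ?_
      have h1 : ‖pev Q x‖ ^ 2 ≤ B ^ 2 := by gcongr; exact hB x hx
      rw [Complex.sq_norm, Complex.normSq_apply] at h1 ⊢
      simp only [Complex.add_re, Complex.add_im, Complex.ofReal_re, Complex.ofReal_im, add_zero]
      nlinarith
    have h2 : ‖(1 + A : ℂ)⁻¹ * (pev Q x + A)‖ ≤ ρ := by
      have : ‖(1 + A : ℂ)‖ = 1 + A := by
        rw [← Complex.ofReal_one, ← Complex.ofReal_add, Complex.norm_real,
          Real.norm_of_nonneg (by positivity)]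
      rw [norm_mul, norm_inv, this, hρ, inv_mul_eq_div]
      gcongr
    have h3 := (Complex.re_le_norm _).trans' h
    rw [pev_mul, pev_pow, pev_mul (MvPolynomial.C (1 + A : ℂ)⁻¹), pev_add, pev_C, pev_C,
      norm_mul, norm_pow] at h3
    have h4 : ‖(1 + A : ℂ)⁻¹ * (pev Q x + A)‖ ^ N ≤ ρ ^ N := by gcongr
    have h5 : (1 / 2 : ℝ) ≤ G * ρ ^ N :=
      h3.trans (mul_le_mul (hG x hx) h4 (by positivity) (by positivity))
    have h6 : G * ρ ^ N < G * (1 / (2 * G)) := by gcongr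
    have h7 : G * (1 / (2 * G)) = 1 / 2 := by field_simp
    linarith

theorem exists_seq_dvd {g : ℕ → MvPolynomial (Fin 2) ℂ} (hg : ∀ k, pev (g k) 0 ≠ 0) :
    ∃ Q : ℕ → MvPolynomial (Fin 2) ℂ, (∀ n, pev (Q n) 0 = 1) ∧ (∀ n, g n ∣ Q n) ∧
      ∀ k n, k ≤ n → ∀ x ∈ closedBall (0 : ℂ × ℂ) 1,
        1 / 2 ≤ (pev (Q n) x).re → 1 / 2 ≤ (pev (Q k) x).re := by
  choose! next h0 hdvd hre using fun (Q g : MvPolynomial (Fin 2) ℂ) (hQ : pev Q 0 = 1)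
    (hg : pev g 0 ≠ 0) => exists_dvd_of_half_le_re hQ hg
  let Q : ℕ → MvPolynomial (Fin 2) ℂ := fun n =>
    Nat.rec (next 1 (g 0)) (fun n q => next q (g (n + 1))) n
  have hQ : ∀ n, pev (Q n) 0 = 1 := by
    intro n
    induction n with
    | zero => exact h0 _ _ (by simp [pev]) (hg 0)
    | succ n ih => exact h0 _ _ ih (hg _)
  refine ⟨Q, hQ, fun n => ?_, fun k n hkn x hx => ?_⟩
  · cases n with
    | zero => exact hdvd _ _ (by simp [pev]) (hg 0)
    | succ n => exact hdvd _ _ (hQ n) (hg _)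
  · induction n, hkn using Nat.le_induction with
    | base => exact id
    | succ n _ ih => exact fun h => ih (hre _ _ (hQ n) (hg _) x hx h)

theorem bidisk_eq_closedBall : bidisk = closedBall (0 : ℂ × ℂ) 1 := by
  ext x
  simp [bidisk, Prod.norm_def]

theorem mem_polyHull_sphere_of_eq_one {Q : MvPolynomial (Fin 2) ℂ} {x : ℂ × ℂ}
    (hx : x ∈ closedBall (0 : ℂ × ℂ) 1) (h : pev Q x = 1) :
    x ∈ polyHull (sphere 0 1 ∩ {y | 1 / 2 ≤ (pev Q y).re}) := by
  intro q M hM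
  have hsph : ∀ y ∈ sphere (0 : ℂ × ℂ) 1, pev Q y = 1 → ‖pev q y‖ ≤ M := fun y hy hy1 =>
    hM y ⟨hy, by simp only [mem_ofPred_eq, hy1, Complex.one_re]; norm_num⟩
  have hF : ∀ y, pev (Q - 1) y = pev Q y - 1 := fun y => by simp [pev]
  rcases (mem_closedBall.1 hx).lt_or_eq with hlt | heq
  · refine norm_le_of_forall_frontier_curve (F := Q - 1) isOpen_ball isBounded_ball
      (fun y _ _ => analyticAt_pev q y) (fun y hy hy0 => ?_) (mem_ball.2 hlt)
      (by rw [hF, h, sub_self])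
    rw [frontier_ball _ one_ne_zero] at hy
    exact hsph y hy (by rwa [hF, sub_eq_zero] at hy0)
  · exact hsph x heq h

theorem mem_polyHull_iInter {Y : ℕ → Set (ℂ × ℂ)} (hY : Antitone Y) (hc : ∀ n, IsCompact (Y n))
    {x : ℕ → ℂ × ℂ} {N : ℕ → ℕ} {a : ℂ × ℂ} (hN : Filter.Tendsto N Filter.atTop Filter.atTop)
    (hx : ∀ j, x j ∈ polyHull (Y (N j))) (ha : Filter.Tendsto x Filter.atTop (𝓝 a)) :
    a ∈ polyHull (⋂ n, Y n) := by
  intro q M hM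
  refine le_of_forall_pos_le_add fun δ hδ => ?_
  obtain ⟨n, hn⟩ := exists_subset_nhds_of_isCompact hY.directed_ge hc
    (U := {y | ‖pev q y‖ < M + δ}) fun y hy =>
      (isOpen_lt (continuous_pev q).norm continuous_const).mem_nhds
        ((hM y hy).trans_lt (lt_add_of_pos_right M hδ))
  refine le_of_tendsto ((continuous_pev q).norm.continuousAt.tendsto.comp ha) ?_
  filter_upwards [hN.eventually_ge_atTop n] with j hj
  exact hx j q _ fun y hy => (hn (hY hj hy)).le

/-- The restriction of a polynomial to a compact set, as an element of `PY`. -/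
noncomputable def pevPY {Y : Set (ℂ × ℂ)} (hY : IsCompact Y) :
    MvPolynomial (Fin 2) ℂ →ₐ[ℂ] PY Y where
  toFun q := ⟨BoundedContinuousFunction.ofNormedAddCommGroup (fun y : Y => pev q y)
      ((continuous_pev q).comp continuous_subtype_val)
      (hY.exists_bound_of_continuousOn (continuous_pev q).continuousOn).choose
      fun y => (hY.exists_bound_of_continuousOn (continuous_pev q).continuousOn).choose_spec y y.2,
    (polySub Y).le_topologicalClosure ⟨q, fun _ => rfl⟩⟩
  map_one' := by ext y; simp [pev]
  map_mul' p q := by ext y; simp [pev]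
  map_zero' := by ext y; simp [pev]
  map_add' p q := by ext y; simp [pev]
  commutes' c := by ext y; simp [pev]

theorem norm_pevPY_le {Y : Set (ℂ × ℂ)} (hY : IsCompact Y) {q : MvPolynomial (Fin 2) ℂ} {C : ℝ}
    (hC : 0 ≤ C) (h : ∀ y ∈ Y, ‖pev q y‖ ≤ C) : ‖pevPY hY q‖ ≤ C :=
  (BoundedContinuousFunction.norm_le (f := (pevPY hY q : Y →ᵇ ℂ)) hC).2 fun y => h y y.2

theorem isUnit_pevPY {Y : Set (ℂ × ℂ)} (hY : IsCompact Y) {q : MvPolynomial (Fin 2) ℂ}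
    (h : ∀ y ∈ Y, 1 / 2 ≤ (pev q y).re) : IsUnit (pevPY hY q) := by
  have : CompleteSpace (PY Y) :=
    (Subalgebra.isClosed_topologicalClosure (polySub Y)).completeSpace_coe
  obtain ⟨B, hB⟩ := hY.exists_bound_of_continuousOn (continuous_pev q).continuousOn
  set A : ℝ := B ^ 2 + 1 with hA
  have hA0 : 0 < A := by positivity
  set ρ : ℝ := √(B ^ 2 - A + A ^ 2) / A with hρ
  have hρ1 : ρ < 1 := by
    rw [hρ, div_lt_one hA0, Real.sqrt_lt' hA0]
    linarith
  have hAC : (A : ℂ) ≠ 0 := by exact_mod_cast hA0.ne'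
  have hev : ∀ y, pev (1 - MvPolynomial.C (A : ℂ)⁻¹ * q) y = (A : ℂ)⁻¹ * (A - pev q y) := by
    intro y
    simp only [pev, map_sub, map_one, map_mul, MvPolynomial.eval_C]
    field_simp
  have hlt : ‖pevPY hY (1 - MvPolynomial.C (A : ℂ)⁻¹ * q)‖ < 1 := by
    refine (norm_pevPY_le hY (by positivity : 0 ≤ ρ) fun y hy => ?_).trans_lt hρ1
    rw [hev, norm_mul, norm_inv, Complex.norm_real, Real.norm_of_nonneg hA0.le, inv_mul_eq_div, hρ]
    gcongr
    refine Real.le_sqrt_of_sq_le ?_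
    have h1 : ‖pev q y‖ ^ 2 ≤ B ^ 2 := by gcongr; exact hB y hy
    have h2 := h y hy
    rw [Complex.sq_norm, Complex.normSq_apply] at h1 ⊢
    simp only [Complex.sub_re, Complex.sub_im, Complex.ofReal_re, Complex.ofReal_im]
    nlinarith
  have hu := isUnit_one_sub_of_norm_lt_one hlt
  rw [← map_one (pevPY hY), ← map_sub, sub_sub_cancel, map_mul] at hu
  exact isUnit_of_mul_isUnit_right hu

theorem dense_isUnit_PY {Y : Set (ℂ × ℂ)} (hY : IsCompact Y) {g : ℕ → MvPolynomial (Fin 2) ℂ}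
    (hg : ∀ (p : MvPolynomial (Fin 2) ℂ) (ε : ℝ), 0 < ε → ∃ k, ∀ y ∈ Y,
      ‖pev p y - pev (g k) y‖ ≤ ε) (hu : ∀ k, IsUnit (pevPY hY (g k))) :
    Dense {f : PY Y | IsUnit f} := by
  intro f
  rw [Metric.mem_closure_iff]
  intro ε hε
  have hf : (f : Y →ᵇ ℂ) ∈ closure (polySub Y : Set (Y →ᵇ ℂ)) := f.2
  obtain ⟨b, ⟨p, hp⟩, hb⟩ := Metric.mem_closure_iff.1 hf (ε / 2) (half_pos hε)
  obtain ⟨k, hk⟩ := hg p (ε / 4) (by positivity)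
  refine ⟨_, hu k, ?_⟩
  have hbp : b = (pevPY hY p : Y →ᵇ ℂ) := by ext y; exact hp y
  have h1 : dist f (pevPY hY p) < ε / 2 := by rw [hbp] at hb; exact hb
  have h2 : dist (pevPY hY p) (pevPY hY (g k)) ≤ ε / 4 := by
    rw [dist_eq_norm, ← map_sub]
    exact norm_pevPY_le hY (by positivity) fun y hy => by simpa [pev] using hk y hy
  linarith [dist_triangle f (pevPY hY p) (pevPY hY (g k))]

/-- If `Q 0 = 1` and `g` has no zeros on the curve `Q = 1` but is close to `z - ζ w`, then that
curve has points with prescribed `‖w‖` and small `‖z - ζ w‖`. -/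
theorem exists_eq_one_norm_snd_eq {Q g : MvPolynomial (Fin 2) ℂ} {ζ : ℂ} {r ε : ℝ} (hr : 0 < r)
    (hε : 0 < ε) (hrε : r + ε ≤ 1) (hζ : ‖ζ‖ ≤ 1) (hQ : pev Q 0 = 1)
    (hg : ∀ x ∈ closedBall (0 : ℂ × ℂ) 1, pev Q x = 1 → pev g x ≠ 0)
    (hgε : ∀ x ∈ closedBall (0 : ℂ × ℂ) 1, ‖(x.1 - ζ * x.2) - pev g x‖ ≤ ε / 4) :
    ∃ x ∈ closedBall (0 : ℂ × ℂ) 1, pev Q x = 1 ∧ ‖x.2‖ = r ∧ ‖x.1 - ζ * x.2‖ ≤ ε := by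
  by_contra! hno
  set Ω : Set (ℂ × ℂ) := {x | ‖x.2‖ < r} ∩ {x | ‖x.1 - ζ * x.2‖ < ε} with hΩ
  have hΩo : IsOpen Ω := (isOpen_lt (by fun_prop) (by fun_prop)).inter
    (isOpen_lt (by fun_prop) (by fun_prop))
  have hcl : ∀ x ∈ closure Ω, ‖x.2‖ ≤ r ∧ ‖x.1 - ζ * x.2‖ ≤ ε := by
    intro x hx
    have hcl' : IsClosed ({x : ℂ × ℂ | ‖x.2‖ ≤ r} ∩ {x | ‖x.1 - ζ * x.2‖ ≤ ε}) :=
      (isClosed_le (by fun_prop) (by fun_prop)).inter (isClosed_le (by fun_prop) (by fun_prop))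
    refine closure_minimal (fun y hy => ?_) hcl' hx
    obtain ⟨h1, h2⟩ := hy
    rw [mem_ofPred_eq] at h1 h2
    exact mem_inter h1.le h2.le
  have hball : ∀ x ∈ closure Ω, x ∈ closedBall (0 : ℂ × ℂ) 1 := by
    intro x hx
    obtain ⟨h1, h2⟩ := hcl x hx
    rw [mem_closedBall_zero_iff, Prod.norm_def, max_le_iff]
    have h3 : ‖x.1‖ ≤ ‖x.1 - ζ * x.2‖ + ‖ζ * x.2‖ := by
      simpa using norm_add_le (x.1 - ζ * x.2) (ζ * x.2)
    have h4 : ‖ζ * x.2‖ ≤ 1 * r := by rw [norm_mul]; gcongr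
    exact ⟨by linarith, by linarith⟩
  have hF : ∀ y, pev (Q - 1) y = 0 ↔ pev Q y = 1 := fun y => by simp [pev, sub_eq_zero]
  have h0 : (0 : ℂ × ℂ) ∈ Ω := ⟨by simpa using hr, by simpa using hε⟩
  have key : ‖(pev g 0)⁻¹‖ ≤ (3 * ε / 4)⁻¹ := by
    refine norm_le_of_forall_frontier_curve (F := Q - 1) (h := fun x => (pev g x)⁻¹) hΩo
      (isBounded_closedBall.subset (subset_closure.trans hball))
      (fun x hx hx1 => (analyticAt_pev g x).inv (hg x (hball x hx) ((hF x).1 hx1)))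
      (fun x hx hx1 => ?_) h0 ((hF 0).2 hQ)
    obtain ⟨h1, h2⟩ := hcl x hx.1
    have hb := hball x hx.1
    have h3 : ‖x.2‖ < r := lt_of_le_of_ne h1 fun h =>
      (hno x hb ((hF x).1 hx1) h).not_ge h2
    have h4 : ‖x.1 - ζ * x.2‖ = ε := by
      refine le_antisymm h2 (not_lt.1 fun h => hx.2 ?_)
      rw [hΩo.interior_eq]
      exact ⟨h3, h⟩
    rw [norm_inv]
    gcongr
    have h5 := norm_sub_norm_le (x.1 - ζ * x.2) (pev g x)
    have h6 := hgε x hb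
    linarith
  have hb0 : (0 : ℂ × ℂ) ∈ closedBall (0 : ℂ × ℂ) 1 := by simp
  have h1 : ‖pev g 0‖ ≤ ε / 4 := by simpa using hgε 0 hb0
  rw [norm_inv, inv_le_inv₀ (norm_pos_iff.2 (hg 0 hb0 hQ)) (by positivity)] at key
  linarith

/-- There exists a nonempty compact `Y ⊆ ∂𝔻̄²` with `(0,0) ∈ Ŷ` and `P(Y)` having dense
invertibles, such that, setting `X = Ŷ` and `E = {(z,w) ∈ X : |w| ≥ 1/4}`, the image of
`E` under the continuous map `η : (z,w) ↦ (|w|, z/w)` into `ℝ × ℂ` contains the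
three-dimensional set `[1/4, 1] × {ζ : |ζ| ≤ 1}`. -/
theorem stmt15 :
    ∃ Y : Set (ℂ × ℂ), Y.Nonempty ∧ IsCompact Y ∧ Y ⊆ frontier bidisk ∧
      ((0 : ℂ), (0 : ℂ)) ∈ polyHull Y ∧
      Dense {f : PY Y | IsUnit f} ∧
      Set.Icc (1/4 : ℝ) 1 ×ˢ Metric.closedBall (0 : ℂ) 1 ⊆
        (fun z : ℂ × ℂ => (‖z.2‖, z.1 / z.2)) ''
          {z : ℂ × ℂ | z ∈ polyHull Y ∧ 1/4 ≤ ‖z.2‖} := by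
  obtain ⟨g, hg0, hg⟩ := exists_seq_dense_pev_ne_zero
  obtain ⟨Q, hQ0, hdvd, hmono⟩ := exists_seq_dvd hg0
  set Y : ℕ → Set (ℂ × ℂ) := fun n => sphere 0 1 ∩ {y | 1 / 2 ≤ (pev (Q n) y).re} with hY
  have hcompact : ∀ n, IsCompact (Y n) := fun n => (isCompact_sphere _ _).inter_right
    (isClosed_le continuous_const (Complex.continuous_re.comp (continuous_pev _)))
  have hanti : Antitone Y := fun k n hkn y hy =>
    ⟨hy.1, hmono k n hkn y (sphere_subset_closedBall hy.1) hy.2⟩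
  have hYc : IsCompact (⋂ n, Y n) :=
    (hcompact 0).of_isClosed_subset (isClosed_iInter fun n => (hcompact n).isClosed)
      (iInter_subset _ 0)
  have hYs : ∀ y ∈ ⋂ n, Y n, y ∈ sphere (0 : ℂ × ℂ) 1 := fun y hy => (mem_iInter.1 hy 0).1
  have hhull : (0 : ℂ × ℂ) ∈ polyHull (⋂ n, Y n) :=
    mem_polyHull_iInter hanti hcompact Filter.tendsto_id
      (fun n => mem_polyHull_sphere_of_eq_one (by simp) (hQ0 n)) tendsto_const_nhds
  refine ⟨⋂ n, Y n, ?_, hYc, ?_, hhull, dense_isUnit_PY hYc (g := g) (fun p ε hε => ?_)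
    (fun k => ?_), ?_⟩
  · by_contra hne
    have := hhull 0 (-1) fun y hy => (hne ⟨y, hy⟩).elim
    linarith [norm_nonneg (pev 0 0)]
  · intro y hy
    rw [bidisk_eq_closedBall, frontier_closedBall _ one_ne_zero]
    exact hYs y hy
  · obtain ⟨k, hk⟩ := hg p ε hε
    exact ⟨k, fun y hy => hk y (sphere_subset_closedBall (hYs y hy))⟩
  · exact isUnit_of_dvd_unit (map_dvd (pevPY hYc) (hdvd k))
      (isUnit_pevPY hYc fun y hy => (mem_iInter.1 hy k).2)
  · rintro ⟨r, ζ⟩ ⟨⟨hr, hr1⟩, hζ⟩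
    simp only at hr hr1
    rw [mem_closedBall_zero_iff] at hζ
    set ε : ℕ → ℝ := fun j => 1 / (8 * (j + 1)) with hεdef
    have hε0 : ∀ j, 0 < ε j := fun j => by positivity
    have hε8 : ∀ j, ε j ≤ 1 / 8 := fun j => by
      have : (0 : ℝ) ≤ j := j.cast_nonneg
      rw [hεdef]
      simp only
      gcongr
      linarith
    have hεlim : Filter.Tendsto ε Filter.atTop (𝓝 0) := by
      have := tendsto_one_div_add_atTop_nhds_zero_nat (𝕜 := ℝ).const_mul (1 / 8)
      refine (this.congr fun j => ?_).trans (by simp)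
      simp only [hεdef]
      field_simp
    have hex : ∀ j : ℕ, ∃ n ≥ j, ∃ x ∈ closedBall (0 : ℂ × ℂ) 1,
        pev (Q n) x = 1 ∧ ‖x.2‖ = r - ε j ∧ ‖x.1 - ζ * x.2‖ ≤ ε j := by
      intro j
      obtain ⟨k, hk⟩ := hg (MvPolynomial.X 0 - MvPolynomial.C ζ * MvPolynomial.X 1) (ε j / 4)
        (by have := hε0 j; positivity)
      refine ⟨max j k, le_max_left _ _, exists_eq_one_norm_snd_eq (g := g k)
        (by linarith [hε8 j]) (hε0 j) (by linarith) hζ (hQ0 _) (fun x hx hx1 hgx => ?_)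
        fun x hx => by simpa [pev] using hk x hx⟩
      have h1 := hmono k _ (le_max_right j k) x hx (by rw [hx1, Complex.one_re]; norm_num)
      obtain ⟨c, hc⟩ := hdvd k
      rw [hc, pev_mul, hgx, zero_mul, Complex.zero_re] at h1
      norm_num at h1
    choose N hN x hxb hx1 hxr hxζ using hex
    obtain ⟨a, -, φ, hφ, ha⟩ := (isCompact_closedBall (0 : ℂ × ℂ) 1).tendsto_subseq hxb
    have hNt : Filter.Tendsto (fun j => N (φ j)) Filter.atTop Filter.atTop :=
      Filter.tendsto_atTop_mono (fun j => (hφ.id_le j).trans (hN _)) Filter.tendsto_id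
    have hmem : a ∈ polyHull (⋂ n, Y n) := mem_polyHull_iInter hanti hcompact hNt
      (fun j => mem_polyHull_sphere_of_eq_one (hxb _) (hx1 _)) ha
    have hεφ := hεlim.comp hφ.tendsto_atTop
    have har : ‖a.2‖ = r := by
      have h1 : Filter.Tendsto (fun j => ‖(x (φ j)).2‖) Filter.atTop (𝓝 ‖a.2‖) :=
        ((continuous_snd.norm).tendsto a).comp ha
      have h2 : Filter.Tendsto (fun j => ‖(x (φ j)).2‖) Filter.atTop (𝓝 (r - 0)) := by
        simp only [hxr]
        exact tendsto_const_nhds.sub hεφ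
      rw [tendsto_nhds_unique h1 h2, sub_zero]
    have haζ : a.1 - ζ * a.2 = 0 := by
      have h1 : Filter.Tendsto (fun j => ‖(x (φ j)).1 - ζ * (x (φ j)).2‖) Filter.atTop
          (𝓝 ‖a.1 - ζ * a.2‖) :=
        ((by fun_prop : Continuous fun y : ℂ × ℂ => ‖y.1 - ζ * y.2‖).tendsto a).comp ha
      exact norm_le_zero_iff.1 (le_of_tendsto_of_tendsto' h1 hεφ fun j => hxζ _)
    have ha0 : a.2 ≠ 0 := norm_pos_iff.1 (by rw [har]; linarith)
    refine ⟨a, ⟨hmem, by rw [har]; exact hr⟩, Prod.ext har ?_⟩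
    rw [sub_eq_zero] at haζ
    simp only
    rw [haζ, mul_div_cancel_right₀ _ ha0]
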